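/- arXiv:2410.02093 — 4 statements merged into one kernel-verified Lean document; each statement's English description precedes it below -/
import Mathlib

section
/- The EIM interpolant reproduces elements of the basis space exactly: if F : Ω → ℝ lies in the span of ψ_1, …, ψ_M, and (β_1, …, β_M) ∈ ℝ^M satisfies the interpolation conditions Σ_{m=1}^M ψ_m(x_p) β_m = F(x_p) for all p = 1, …, M, then Σ_{m=1}^M β_m ψ_m(x) = F(x) for every x ∈ Ω. -/
/-- A combination of functions that are unitriangular at the points `x` has zero coefficients
as soon as it vanishes at these points. -/
theorem eq_zero_of_sum_unitriangular_eq_zero {Ω R ι : Type*} [Semiring R] [Fintype ι]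
    [LinearOrder ι] {ψ : ι → Ω → R} {x : ι → Ω} (hdiag : ∀ m, ψ m (x m) = 1)
    (htri : ∀ p m, p < m → ψ m (x p) = 0) {d : ι → R}
    (hd : ∀ p, ∑ m, ψ m (x p) * d m = 0) (p : ι) : d p = 0 := by
  induction p using WellFoundedLT.induction with
  | ind p ih =>
    have h := hd p
    rw [Finset.sum_eq_single p] at h
    · simpa [hdiag] using h
    · intro m _ hmp
      rcases lt_or_gt_of_ne hmp with hlt | hgt
      · rw [ih m hlt, mul_zero]
      · rw [htri p m hgt, zero_mul]
    · simp

/-- The EIM interpolant reproduces elements of the basis space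
exactly: if `F` lies in the span of `ψ_1, …, ψ_M` and `β` satisfies the
interpolation conditions, then `∑_m β m * ψ m = F` on all of `Ω`. -/
theorem eim_interpolant_reproduces_span
    (Ω : Type*) [Nonempty Ω] (M : ℕ) (hM : 0 < M)
    (ψ : Fin M → Ω → ℝ) (x : Fin M → Ω)
    (hdiag : ∀ m : Fin M, ψ m (x m) = 1)
    (htri : ∀ p m : Fin M, p < m → ψ m (x p) = 0)
    (F : Ω → ℝ)
    (hF : F ∈ Submodule.span ℝ (Set.range ψ))
    (β : Fin M → ℝ)
    (hβ : ∀ p : Fin M, ∑ m : Fin M, ψ m (x p) * β m = F (x p)) :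
    ∀ y : Ω, ∑ m : Fin M, β m * ψ m y = F y := by
  obtain ⟨c, rfl⟩ := (Submodule.mem_span_range_iff_exists_fun ℝ).mp hF
  have hβc : ∀ m, β m - c m = 0 := by
    refine eq_zero_of_sum_unitriangular_eq_zero hdiag htri fun p => ?_
    simp [mul_sub, Finset.sum_sub_distrib, hβ, mul_comm]
  intro y
  simp [sub_eq_zero.mp (hβc _)]
end

section
/- Any function in the extended EIM space that vanishes at the first M interpolation points lies in the span of the last P basis functions: if E : Ω → ℝ lies in the span of ψ_1, …, ψ_{M+P} and E(x_p) = 0 for all p = 1, …, M, then E lies in the span of ψ_{M+1}, …, ψ_{M+P}. -/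
/-- If a combination of functions that is unit lower triangular at the points `x` vanishes at every
point of index below `k`, then its coefficients of index below `k` are zero. -/
theorem coeff_eq_zero_of_triangular_of_vanishing {Ω R : Type*} [Semiring R] {n k : ℕ}
    {ψ : Fin n → Ω → R} {x : Fin n → Ω} (hdiag : ∀ m, ψ m (x m) = 1)
    (htri : ∀ p m, p < m → ψ m (x p) = 0) (c : Fin n → R)
    (hvanish : ∀ p : Fin n, p.val < k → (∑ m, c m • ψ m) (x p) = 0)
    (p : Fin n) (hp : p.val < k) : c p = 0 := by
  induction p using WellFoundedLT.induction with
  | ind p ih =>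
    have h := hvanish p hp
    rw [Finset.sum_apply, Finset.sum_eq_single p] at h
    · simpa [hdiag] using h
    · intro m _ hm
      rcases lt_or_gt_of_ne hm with hlt | hgt
      · simp [ih m hlt (lt_trans hlt hp)]
      · simp [htri p m hgt]
    · simp

/-- Any function in the extended EIM space that vanishes at the
first `M` interpolation points lies in the span of the last `P` basis
functions. -/
theorem eim_vanishing_in_tail_span
    (Ω : Type*) [Nonempty Ω] (M P : ℕ) (hM : 0 < M) (hP : 0 < P)
    (ψ : Fin (M + P) → Ω → ℝ) (x : Fin (M + P) → Ω)
    (hdiag : ∀ m : Fin (M + P), ψ m (x m) = 1)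
    (htri : ∀ p m : Fin (M + P), p < m → ψ m (x p) = 0)
    (E : Ω → ℝ)
    (hE : E ∈ Submodule.span ℝ (Set.range ψ))
    (hvanish : ∀ p : Fin M, E (x (Fin.castAdd P p)) = 0) :
    E ∈ Submodule.span ℝ (Set.range fun j : Fin P => ψ (Fin.natAdd M j)) := by
  obtain ⟨c, rfl⟩ := (Submodule.mem_span_range_iff_exists_fun ℝ).1 hE
  have hc : ∀ p : Fin (M + P), p.val < M → c p = 0 :=
    coeff_eq_zero_of_triangular_of_vanishing hdiag htri c fun p hp => hvanish ⟨p, hp⟩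
  rw [Fin.sum_univ_add, Finset.sum_eq_zero fun p _ => by simp [hc (Fin.castAdd P p) p.isLt],
    zero_add]
  exact Submodule.sum_mem _ fun j _ =>
    Submodule.smul_mem _ _ (Submodule.subset_span (Set.mem_range_self j))
end

section
/- The EIM interpolation error admits the exact representation F − F_M = Σ_{j=1}^P e_j ψ_{M+j}: suppose F : Ω → ℝ lies in the span of ψ_1, …, ψ_{M+P}; let (β_1, …, β_M) ∈ ℝ^M satisfy the interpolation conditions Σ_{m=1}^M ψ_m(x_p) β_m = F(x_p) for p = 1, …, M, and set F_M = Σ_{m=1}^M β_m ψ_m; let (e_1, …, e_P) ∈ ℝ^P satisfy Σ_{j=1}^P ψ_{M+j}(x_{M+i}) e_j = F(x_{M+i}) − F_M(x_{M+i}) for i = 1, …, P. Then F(x) − F_M(x) = Σ_{j=1}^P e_j ψ_{M+j}(x) for every x ∈ Ω. -/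
/-- Functions that are unitriangular with respect to a family of points have only the trivial
linear combination vanishing at all of these points. -/
theorem coeff_eq_zero_of_unitriangular {R Ω : Type*} [Semiring R] {n : ℕ}
    {ψ : Fin n → Ω → R} {x : Fin n → Ω} (hdiag : ∀ m, ψ m (x m) = 1)
    (htri : ∀ p m, p < m → ψ m (x p) = 0) {d : Fin n → R}
    (hd : ∀ p, ∑ m, d m * ψ m (x p) = 0) (p : Fin n) : d p = 0 := by
  induction p using WellFoundedLT.induction with
  | ind p ih =>
    have h := hd p
    rw [Finset.sum_eq_single p] at h
    · simpa [hdiag] using h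
    · intro m _ hm
      rcases lt_or_gt_of_ne hm with hlt | hgt
      · simp [ih m hlt]
      · simp [htri p m hgt]
    · simp

/-- Exact representation of the EIM interpolation error:
`F − F_M = ∑_{j=1}^P e_j ψ_{M+j}` on all of `Ω`. -/
theorem eim_error_exact_representation
    (Ω : Type*) [Nonempty Ω] (M P : ℕ) (hM : 0 < M) (hP : 0 < P)
    (ψ : Fin (M + P) → Ω → ℝ) (x : Fin (M + P) → Ω)
    (hdiag : ∀ m : Fin (M + P), ψ m (x m) = 1)
    (htri : ∀ p m : Fin (M + P), p < m → ψ m (x p) = 0)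
    (F : Ω → ℝ)
    (hF : F ∈ Submodule.span ℝ (Set.range ψ))
    (β : Fin M → ℝ)
    (hβ : ∀ p : Fin M,
      ∑ m : Fin M, ψ (Fin.castAdd P m) (x (Fin.castAdd P p)) * β m
        = F (x (Fin.castAdd P p)))
    (F_M : Ω → ℝ)
    (hFM : ∀ y : Ω, F_M y = ∑ m : Fin M, β m * ψ (Fin.castAdd P m) y)
    (e : Fin P → ℝ)
    (he : ∀ i : Fin P,
      ∑ j : Fin P, ψ (Fin.natAdd M j) (x (Fin.natAdd M i)) * e j
        = F (x (Fin.natAdd M i)) - F_M (x (Fin.natAdd M i))) :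
    ∀ y : Ω, F y - F_M y = ∑ j : Fin P, e j * ψ (Fin.natAdd M j) y := by
  obtain ⟨c, rfl⟩ := (Submodule.mem_span_range_iff_exists_fun ℝ).1 hF
  have hres : ∀ y, ∑ m, (c m - Fin.append β e m) * ψ m y =
      (∑ m, c m • ψ m) y - F_M y - ∑ j : Fin P, e j * ψ (Fin.natAdd M j) y := by
    intro y
    have happend : ∑ m, Fin.append β e m * ψ m y =
        F_M y + ∑ j : Fin P, e j * ψ (Fin.natAdd M j) y := by
      simp [Fin.sum_univ_add, hFM]
    simp only [sub_mul, Finset.sum_sub_distrib, happend, Finset.sum_apply, Pi.smul_apply,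
      smul_eq_mul]
    ring
  have hzero : ∀ p, c p - Fin.append β e p = 0 := by
    refine coeff_eq_zero_of_unitriangular hdiag htri fun p => ?_
    rw [hres]
    induction p using Fin.addCases with
    | left p =>
      have htail : ∀ j : Fin P, ψ (Fin.natAdd M j) (x (Fin.castAdd P p)) = 0 := fun j =>
        htri _ _ (Fin.lt_def.2 (by simp; omega))
      rw [← hβ p, hFM]
      simp [htail, mul_comm]
    | right i =>
      rw [← he i]
      simp [mul_comm]
  intro y
  have h := hres y
  simp only [hzero, zero_mul, Finset.sum_const_zero] at h
  linarith
end

section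
/- Error estimate of the first-order empirical interpolation method (Theorem 1): suppose additionally that |ψ_m(x)| ≤ 1 for all x ∈ Ω and all m = 1, …, M+P. Suppose F : Ω → ℝ lies in the span of ψ_1, …, ψ_{M+P}; let (β_1, …, β_M) ∈ ℝ^M satisfy the interpolation conditions Σ_{m=1}^M ψ_m(x_p) β_m = F(x_p) for p = 1, …, M, and set F_M = Σ_{m=1}^M β_m ψ_m; let (e_1, …, e_P) ∈ ℝ^P satisfy Σ_{j=1}^P ψ_{M+j}(x_{M+i}) e_j = F(x_{M+i}) − F_M(x_{M+i}) for i = 1, …, P. Then the interpolation error is bounded by the computable estimator: |F(x) − F_M(x)| ≤ Σ_{j=1}^P |e_j| for every x ∈ Ω. -/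
/-- A linear combination of a triangular family with unit diagonal that vanishes at all the
nodes has zero coefficients. -/
theorem coeff_eq_zero_of_triangular {Ω : Type*} {n : ℕ} {ψ : Fin n → Ω → ℝ} {x : Fin n → Ω}
    (hdiag : ∀ m, ψ m (x m) = 1) (htri : ∀ p m, p < m → ψ m (x p) = 0) {d : Fin n → ℝ}
    (hd : ∀ p, ∑ m, d m * ψ m (x p) = 0) (p : Fin n) : d p = 0 := by
  induction p using WellFoundedLT.induction with
  | ind p ih =>
    have h := hd p
    rw [Finset.sum_eq_single p] at h
    · simpa [hdiag] using h
    · intro m _ hm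
      rcases lt_or_gt_of_ne hm with h1 | h1
      · rw [ih m h1, zero_mul]
      · rw [htri p m h1, mul_zero]
    · simp

/-- Theorem 1 of the paper: Error estimate of the first-order
empirical interpolation method. If moreover `|ψ m y| ≤ 1` for all `y` and `m`,
then `|F(x) − F_M(x)| ≤ ∑_{j=1}^P |e_j|` for every `x ∈ Ω`. -/
theorem foeim_error_estimate
    (Ω : Type*) [Nonempty Ω] (M P : ℕ) (hM : 0 < M) (hP : 0 < P)
    (ψ : Fin (M + P) → Ω → ℝ) (x : Fin (M + P) → Ω)
    (hdiag : ∀ m : Fin (M + P), ψ m (x m) = 1)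
    (htri : ∀ p m : Fin (M + P), p < m → ψ m (x p) = 0)
    (hbound : ∀ (y : Ω) (m : Fin (M + P)), |ψ m y| ≤ 1)
    (F : Ω → ℝ)
    (hF : F ∈ Submodule.span ℝ (Set.range ψ))
    (β : Fin M → ℝ)
    (hβ : ∀ p : Fin M,
      ∑ m : Fin M, ψ (Fin.castAdd P m) (x (Fin.castAdd P p)) * β m
        = F (x (Fin.castAdd P p)))
    (F_M : Ω → ℝ)
    (hFM : ∀ y : Ω, F_M y = ∑ m : Fin M, β m * ψ (Fin.castAdd P m) y)
    (e : Fin P → ℝ)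
    (he : ∀ i : Fin P,
      ∑ j : Fin P, ψ (Fin.natAdd M j) (x (Fin.natAdd M i)) * e j
        = F (x (Fin.natAdd M i)) - F_M (x (Fin.natAdd M i))) :
    ∀ y : Ω, |F y - F_M y| ≤ ∑ j : Fin P, |e j| := by
  obtain ⟨c, rfl⟩ := (Submodule.mem_span_range_iff_exists_fun ℝ).1 hF
  have heval : ∀ y, (∑ m, c m • ψ m) y = ∑ m, c m * ψ m y := fun y => by
    simp [Finset.sum_apply]
  have hcoeff : ∀ p, c p - Fin.append β e p = 0 := by
    refine coeff_eq_zero_of_triangular hdiag htri fun p => ?_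
    simp only [sub_mul, Finset.sum_sub_distrib]
    rw [← heval, Fin.sum_univ_add fun m => Fin.append β e m * ψ m (x p)]
    simp only [Fin.append_left, Fin.append_right]
    refine Fin.addCases (fun i => ?_) (fun i => ?_) p
    · have hzero : ∀ j : Fin P, ψ (Fin.natAdd M j) (x (Fin.castAdd P i)) = 0 := fun j =>
        htri _ _ (by simp only [Fin.lt_def, Fin.val_castAdd, Fin.val_natAdd]; omega)
      rw [← hβ i]
      simp [hzero, mul_comm]
    · have h := he i
      rw [hFM] at h
      simp only [mul_comm (ψ (Fin.natAdd M _) _)] at h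
      rw [h]
      ring
  intro y
  have herr : (∑ m, c m • ψ m) y - F_M y = ∑ j, e j * ψ (Fin.natAdd M j) y := by
    rw [heval, hFM, Fin.sum_univ_add]
    simp only [fun p => sub_eq_zero.1 (hcoeff p), Fin.append_left, Fin.append_right]
    ring
  rw [herr]
  refine (Finset.abs_sum_le_sum_abs _ _).trans (Finset.sum_le_sum fun j _ => ?_)
  rw [abs_mul]
  exact mul_le_of_le_one_right (abs_nonneg _) (hbound y _)
end
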